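/- Let P = ⟨H,M,T⟩ be an abduction problem with H = {h₁,…,hₙ}, and let C = {c₁,…,cₙ}, D = {d₁,…,dₙ}, E = {e₁,…,eₙ} be sets of fresh propositional variables in one-to-one correspondence with H. Define P' = ⟨H',M',T'⟩ by H' = C ∪ D, M' = M ∪ E, and T' = { cᵢ → hᵢ, cᵢ → eᵢ, dᵢ → eᵢ : 1 ≤ i ≤ n } ∪ T. Then every minimum-cardinality solution of P' contains, for each index i, exactly one of cᵢ and dᵢ, and hence has cardinality exactly |H| = n. -/

import Mathlib

/-- Propositional formulas over a set `V` of variables. -/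
inductive PropForm (V : Type) : Type where
  | fls  : PropForm V
  | var  : V → PropForm V
  | neg  : PropForm V → PropForm V
  | conj : PropForm V → PropForm V → PropForm V
  | disj : PropForm V → PropForm V → PropForm V
  | imp  : PropForm V → PropForm V → PropForm V
  deriving DecidableEq

namespace PropForm

/-- Truth of a formula under a valuation. -/
def eval {V : Type} (v : V → Prop) : PropForm V → Prop
  | fls => False
  | var x => v x
  | neg φ => ¬ eval v φ
  | conj φ ψ => eval v φ ∧ eval v ψ
  | disj φ ψ => eval v φ ∨ eval v ψ
  | imp φ ψ => eval v φ → eval v ψ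

/-- The set of variables occurring in a formula. -/
def vars {V : Type} : PropForm V → Set V
  | fls => ∅
  | var x => {x}
  | neg φ => vars φ
  | conj φ ψ => vars φ ∪ vars ψ
  | disj φ ψ => vars φ ∪ vars ψ
  | imp φ ψ => vars φ ∪ vars ψ

end PropForm

/-- An abduction problem `⟨H, M, T⟩`: hypotheses, manifestations, theory. -/
structure AbdProblem (V : Type) [DecidableEq V] : Type where
  H : Finset V
  M : Finset V
  T : Finset (PropForm V)

variable {V : Type} [DecidableEq V]

/-- `v` is a model of the hypotheses `A` together with the theory `T`. -/
def models (v : V → Prop) (A : Finset V) (T : Finset (PropForm V)) : Prop :=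
  (∀ x ∈ A, v x) ∧ (∀ φ ∈ T, φ.eval v)

/-- `A` is a solution of `P`: `A ⊆ H`, `A ∪ T` is satisfiable, `A ∪ T ⊨ m` for `m ∈ M`. -/
def isSol (P : AbdProblem V) (A : Finset V) : Prop :=
  A ⊆ P.H ∧ (∃ v, models v A P.T) ∧ ∀ v, models v A P.T → ∀ m ∈ P.M, v m

/-- The set of solutions of `P`. -/
def SOL (P : AbdProblem V) : Set (Finset V) := {A | isSol P A}

/-- The solutions of `P` minimal under set inclusion. -/
def SOLsub (P : AbdProblem V) : Set (Finset V) :=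
  {A | A ∈ SOL P ∧ ∀ B ∈ SOL P, B ⊆ A → B = A}

/-- The solutions of `P` of minimum cardinality. -/
def SOLcard (P : AbdProblem V) : Set (Finset V) :=
  {A | A ∈ SOL P ∧ ∀ B ∈ SOL P, A.card ≤ B.card}

/-- `x` is fresh for `P`: it occurs neither in `H`, nor in `M`, nor in any formula of `T`. -/
def freshFor (P : AbdProblem V) (x : V) : Prop :=
  x ∉ P.H ∧ x ∉ P.M ∧ ∀ φ ∈ P.T, x ∉ φ.vars

/-- The problem `P' = ⟨C ∪ D, M ∪ E, {cᵢ → hᵢ, cᵢ → eᵢ, dᵢ → eᵢ : i} ∪ T⟩`. -/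
def splitProb (P : AbdProblem V) {n : ℕ} (h c d e : Fin n → V) : AbdProblem V where
  H := Finset.univ.image c ∪ Finset.univ.image d
  M := P.M ∪ Finset.univ.image e
  T := Finset.univ.image (fun i => PropForm.imp (PropForm.var (c i)) (PropForm.var (h i)))
    ∪ Finset.univ.image (fun i => PropForm.imp (PropForm.var (c i)) (PropForm.var (e i)))
    ∪ Finset.univ.image (fun i => PropForm.imp (PropForm.var (d i)) (PropForm.var (e i)))
    ∪ P.T

theorem PropForm.eval_congr {V : Type} {v w : V → Prop} :
    ∀ {φ : PropForm V}, (∀ x ∈ φ.vars, v x ↔ w x) → (φ.eval v ↔ φ.eval w)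
  | .fls, _ => Iff.rfl
  | .var x, hx => hx x rfl
  | .neg _, hx => not_congr (eval_congr hx)
  | .conj _ _, hx => and_congr (eval_congr fun x hxv => hx x (Or.inl hxv))
      (eval_congr fun x hxv => hx x (Or.inr hxv))
  | .disj _ _, hx => or_congr (eval_congr fun x hxv => hx x (Or.inl hxv))
      (eval_congr fun x hxv => hx x (Or.inr hxv))
  | .imp _ _, hx => imp_congr (eval_congr fun x hxv => hx x (Or.inl hxv))
      (eval_congr fun x hxv => hx x (Or.inr hxv))

theorem models_splitProb_iff (P : AbdProblem V) {n : ℕ} (h c d e : Fin n → V)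
    (v : V → Prop) (A : Finset V) :
    models v A (splitProb P h c d e).T ↔
      (∀ x ∈ A, v x) ∧ (∀ i, v (c i) → v (h i)) ∧ (∀ i, v (c i) → v (e i)) ∧
        (∀ i, v (d i) → v (e i)) ∧ ∀ φ ∈ P.T, φ.eval v := by
  simp only [models, splitProb, Finset.mem_union, Finset.mem_image, Finset.mem_univ, true_and,
    or_imp, forall_and, forall_exists_index, forall_apply_eq_imp_iff, PropForm.eval, and_assoc]

/-- A solution of the split problem contains at least one of `c i` and `d i`. -/
theorem mem_or_mem_of_mem_SOL_splitProb {P : AbdProblem V} {n : ℕ} {h c d e : Fin n → V}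
    (hH : P.H = Finset.univ.image h) (einj : Function.Injective e)
    (cfresh : ∀ i, freshFor P (c i)) (dfresh : ∀ i, freshFor P (d i))
    (efresh : ∀ i, freshFor P (e i))
    (ce : ∀ i j, c i ≠ e j) (de : ∀ i j, d i ≠ e j)
    {A : Finset V} (hA : A ∈ SOL (splitProb P h c d e)) (i : Fin n) :
    c i ∈ A ∨ d i ∈ A := by
  obtain ⟨hsub, ⟨v, hv⟩, hent⟩ := hA
  by_contra! hne
  rw [models_splitProb_iff] at hv
  obtain ⟨hvA, hvch, hvce, hvde, hvT⟩ := hv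
  let w : V → Prop := fun x => v x ∧ x ≠ c i ∧ x ≠ d i ∧ x ≠ e i
  have hw : models w A (splitProb P h c d e).T := by
    rw [models_splitProb_iff]
    refine ⟨fun x hx => ⟨hvA x hx, ?_, ?_, ?_⟩, ?_, ?_, ?_, fun φ hφ => ?_⟩
    · rintro rfl; exact hne.1 hx
    · rintro rfl; exact hne.2 hx
    · rintro rfl
      have := hsub hx
      simp only [splitProb, Finset.mem_union, Finset.mem_image, Finset.mem_univ, true_and] at this
      rcases this with ⟨j, hj⟩ | ⟨j, hj⟩
      · exact ce _ _ hj
      · exact de _ _ hj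
    · rintro j ⟨hj, -⟩
      have hjH : h j ∈ P.H := by simp [hH]
      refine ⟨hvch j hj, ?_, ?_, ?_⟩ <;> intro heq <;> rw [heq] at hjH
      · exact (cfresh i).1 hjH
      · exact (dfresh i).1 hjH
      · exact (efresh i).1 hjH
    · rintro j ⟨hj, hji, -⟩
      exact ⟨hvce j hj, (ce _ _).symm, (de _ _).symm, fun heq => hji (congrArg c (einj heq))⟩
    · rintro j ⟨hj, -, hji, -⟩
      exact ⟨hvde j hj, (ce _ _).symm, (de _ _).symm, fun heq => hji (congrArg d (einj heq))⟩
    · refine (PropForm.eval_congr fun x hx => ?_).1 (hvT φ hφ)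
      refine (and_iff_left ⟨?_, ?_, ?_⟩).symm <;> rintro rfl
      · exact (cfresh i).2.2 φ hφ hx
      · exact (dfresh i).2.2 φ hφ hx
      · exact (efresh i).2.2 φ hφ hx
  exact (hent w hw (e i) (by simp [splitProb])).2.2.2 rfl

/-- If a solution of the split problem contains both `c i` and `d i`, then `d i` is redundant. -/
theorem erase_mem_SOL_splitProb {P : AbdProblem V} {n : ℕ} {h c d e : Fin n → V}
    (dinj : Function.Injective d)
    (dfresh : ∀ i, freshFor P (d i)) (cd : ∀ i j, c i ≠ d j) (de : ∀ i j, d i ≠ e j)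
    {A : Finset V} (hA : A ∈ SOL (splitProb P h c d e)) {i : Fin n} (hc : c i ∈ A) :
    A.erase (d i) ∈ SOL (splitProb P h c d e) := by
  obtain ⟨hsub, ⟨v, hvA, hvT⟩, hent⟩ := hA
  refine ⟨(Finset.erase_subset _ _).trans hsub,
    ⟨v, fun x hx => hvA x (Finset.mem_of_mem_erase hx), hvT⟩, fun u hu m hm => ?_⟩
  rw [models_splitProb_iff] at hu
  obtain ⟨huA, huch, huce, hude, huT⟩ := hu
  have hui : u (c i) := huA _ (Finset.mem_erase.2 ⟨cd _ _, hc⟩)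
  let w : V → Prop := fun x => u x ∨ x = d i
  have hw : models w A (splitProb P h c d e).T := by
    rw [models_splitProb_iff]
    refine ⟨fun x hx => ?_, fun j hj => ?_, fun j hj => ?_, fun j hj => ?_, fun φ hφ => ?_⟩
    · by_cases hxd : x = d i
      · exact Or.inr hxd
      · exact Or.inl (huA x (Finset.mem_erase.2 ⟨hxd, hx⟩))
    · exact Or.inl (huch j (hj.resolve_right (cd _ _)))
    · exact Or.inl (huce j (hj.resolve_right (cd _ _)))
    · rcases hj with hj | hj
      · exact Or.inl (hude j hj)
      · rw [dinj hj]; exact Or.inl (huce i hui)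
    · refine (PropForm.eval_congr fun x hx => ?_).1 (huT φ hφ)
      refine (or_iff_left ?_).symm
      rintro rfl
      exact (dfresh i).2.2 φ hφ hx
  refine (hent w hw m hm).resolve_right ?_
  rintro rfl
  simp only [splitProb, Finset.mem_union, Finset.mem_image, Finset.mem_univ, true_and] at hm
  rcases hm with hm | ⟨j, hj⟩
  · exact (dfresh i).2.1 hm
  · exact de _ _ hj.symm

theorem split_min_solution_exactly_one (P : AbdProblem V) (n : ℕ) (h c d e : Fin n → V)
    (hH : P.H = Finset.univ.image h)
    (hinj : Function.Injective h) (cinj : Function.Injective c)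
    (dinj : Function.Injective d) (einj : Function.Injective e)
    (cfresh : ∀ i, freshFor P (c i)) (dfresh : ∀ i, freshFor P (d i))
    (efresh : ∀ i, freshFor P (e i))
    (cd : ∀ i j, c i ≠ d j) (ce : ∀ i j, c i ≠ e j) (de : ∀ i j, d i ≠ e j)
    (H₂ : Finset V) (hH₂ : H₂ ∈ SOLcard (splitProb P h c d e)) :
    (∀ i, (c i ∈ H₂ ∧ d i ∉ H₂) ∨ (c i ∉ H₂ ∧ d i ∈ H₂)) ∧
    H₂.card = P.H.card ∧ P.H.card = n := by
  obtain ⟨hsol, hmin⟩ := hH₂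
  have one : ∀ i, (c i ∈ H₂ ∧ d i ∉ H₂) ∨ (c i ∉ H₂ ∧ d i ∈ H₂) := fun i => by
    have hor := mem_or_mem_of_mem_SOL_splitProb hH einj cfresh dfresh efresh ce de hsol i
    have hnot : ¬ (c i ∈ H₂ ∧ d i ∈ H₂) := fun ⟨hci, hdi⟩ =>
      (Finset.card_erase_lt_of_mem hdi).not_ge
        (hmin _ (erase_mem_SOL_splitProb dinj dfresh cd de hsol hci))
    tauto
  have hn : P.H.card = n := by
    rw [hH, Finset.card_image_of_injective _ hinj, Finset.card_univ, Fintype.card_fin]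
  refine ⟨one, ?_, hn⟩
  let f : Fin n → V := fun i => if c i ∈ H₂ then c i else d i
  have hf : Function.Injective f := fun i j hij => by
    simp only [f] at hij
    split_ifs at hij
    · exact cinj hij
    · exact absurd hij (cd _ _)
    · exact absurd hij.symm (cd _ _)
    · exact dinj hij
  have himage : H₂ = Finset.univ.image f := by
    ext x
    simp only [Finset.mem_image, Finset.mem_univ, true_and]
    constructor
    · intro hx
      have hx' := hsol.1 hx
      simp only [splitProb, Finset.mem_union, Finset.mem_image, Finset.mem_univ, true_and] at hx'
      rcases hx' with ⟨i, rfl⟩ | ⟨i, rfl⟩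
      · exact ⟨i, if_pos hx⟩
      · exact ⟨i, if_neg fun hci => by have := one i; tauto⟩
    · rintro ⟨i, rfl⟩
      have := one i
      simp only [f]
      split_ifs <;> tauto
  rw [hn, himage, Finset.card_image_of_injective _ hf, Finset.card_univ, Fintype.card_fin]
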